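/- arXiv:1808.05013 — 2 statements merged into one kernel-verified Lean document; each statement's English description precedes it below -/
import Mathlib

section
/- Let κ, μ, r̂ > 0, m_t > 1 and r > 0. Then the mixture of the scaled κ-μ density against the unit-power inverse Nakagami-m density satisfies ∫₀^∞ (2μ(1+κ)^{(μ+1)/2} r^μ e^{−μ(1+κ)r²/(x²r̂²)} / (κ^{(μ−1)/2} e^{κμ} (x²r̂²)^{(μ+1)/2})) · I_{μ−1}(2μ√(κ(1+κ)) r/(x r̂)) · (2(m_t−1)^{m_t} x^{−2m_t−1} e^{−(m_t−1)/x²}/Γ(m_t)) dx = (2(1+κ)^μ μ^μ e^{−κμ} ((m_t−1)r̂²)^{m_t} r^{2μ−1} / (B(m_t,μ)(r̂²(m_t−1) + r²(1+κ)μ)^{m_t+μ})) · ₁F₁(m_t+μ; μ; μ²κ(1+κ)r² / (r̂²(m_t−1) + r²(1+κ)μ)). -/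
open MeasureTheory Set

/-- Pochhammer (rising factorial) symbol `(a)_n = Γ(a+n)/Γ(a)`. -/
noncomputable def poch (a : ℝ) (n : ℕ) : ℝ := Real.Gamma (a + n) / Real.Gamma a

/-- Beta function `B(x,y) = Γ(x)Γ(y)/Γ(x+y)`. -/
noncomputable def betaFn (x y : ℝ) : ℝ := Real.Gamma x * Real.Gamma y / Real.Gamma (x + y)

/-- Modified Bessel function of the first kind of real order ν. -/
noncomputable def besselI (ν x : ℝ) : ℝ :=
  ∑' k : ℕ, (x / 2) ^ (ν + 2 * (k : ℝ)) / ((k.factorial : ℝ) * Real.Gamma (ν + (k : ℝ) + 1))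

/-- Modified Bessel function of the second kind of real order ν. -/
noncomputable def besselK (ν x : ℝ) : ℝ :=
  ∫ t in Ioi (0 : ℝ), Real.exp (-x * Real.cosh t) * Real.cosh (ν * t)

/-- Confluent hypergeometric function ₁F₁(a;b;z). -/
noncomputable def hyp1F1 (a b z : ℝ) : ℝ :=
  ∑' n : ℕ, poch a n * z ^ n / (poch b n * (n.factorial : ℝ))

/-- Gauss hypergeometric function ₂F₁(a,b;c;z). -/
noncomputable def hyp2F1 (a b c z : ℝ) : ℝ :=
  ∑' n : ℕ, poch a n * poch b n * z ^ n / (poch c n * (n.factorial : ℝ))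

/-- Tricomi confluent hypergeometric function U(a,b,z). -/
noncomputable def tricomiU (a b z : ℝ) : ℝ :=
  (1 / Real.Gamma a) *
    ∫ t in Ioi (0 : ℝ), Real.exp (-z * t) * t ^ (a - 1) * (1 + t) ^ (b - a - 1)

/-- Regularized generalized hypergeometric function ₃F̃₁(a₁,a₂,a₃;b;z). -/
noncomputable def hyp3F1reg (a₁ a₂ a₃ b z : ℝ) : ℝ :=
  ∑' n : ℕ, poch a₁ n * poch a₂ n * poch a₃ n * z ^ n /
    (Real.Gamma (b + n) * (n.factorial : ℝ))

/-- Regularized generalized hypergeometric function ₂F̃₂(a,b;c,d;z). -/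
noncomputable def hyp2F2reg (a b c d z : ℝ) : ℝ :=
  ∑' n : ℕ, poch a n * poch b n * z ^ n /
    (Real.Gamma (c + n) * Real.Gamma (d + n) * (n.factorial : ℝ))

theorem integral_rpow_mul_exp_neg_div_sq {s A : ℝ} (hs : 0 < s) (hA : 0 < A) :
    ∫ x in Ioi (0 : ℝ), x ^ (-2 * s - 1) * Real.exp (-A / x ^ 2) =
      Real.Gamma s * A ^ (-s) / 2 := by
  have h := integral_comp_rpow_Ioi (fun t : ℝ => t ^ (s - 1) * Real.exp (-(A * t)))
    (p := -2) (by norm_num)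
  rw [Real.integral_rpow_mul_exp_neg_mul_Ioi hs hA] at h
  have h2 : ∫ x in Ioi (0 : ℝ), (|(-2 : ℝ)| * x ^ ((-2 : ℝ) - 1)) •
      ((x ^ (-2 : ℝ)) ^ (s - 1) * Real.exp (-(A * x ^ (-2 : ℝ)))) =
      ∫ x in Ioi (0 : ℝ), 2 * (x ^ (-2 * s - 1) * Real.exp (-A / x ^ 2)) := by
    refine setIntegral_congr_fun measurableSet_Ioi fun x hx => ?_
    have hx : 0 < x := hx
    have e1 : x ^ (-2 : ℝ) = (x ^ 2)⁻¹ := by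
      rw [Real.rpow_neg hx.le, Real.rpow_two]
    have e2 : x ^ (-2 * s - 1) = x ^ ((-2 : ℝ) - 1) * (x ^ (-2 : ℝ)) ^ (s - 1) := by
      rw [← Real.rpow_mul hx.le, ← Real.rpow_add hx]
      ring_nf
    simp only [e2, smul_eq_mul]
    rw [show -(A * x ^ (-2 : ℝ)) = -A / x ^ 2 by rw [e1]; ring]
    norm_num
    ring
  rw [h2, integral_const_mul] at h
  rw [Real.rpow_neg hA.le, ← Real.inv_rpow hA.le, ← one_div A]
  linarith

theorem integrableOn_rpow_mul_exp_neg_div_sq {s A : ℝ} (hs : 0 < s) (hA : 0 < A) :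
    IntegrableOn (fun x : ℝ => x ^ (-2 * s - 1) * Real.exp (-A / x ^ 2)) (Ioi 0) := by
  refine Integrable.of_integral_ne_zero ?_
  rw [integral_rpow_mul_exp_neg_div_sq hs hA]
  positivity

theorem poch_succ {a : ℝ} (ha : 0 < a) (n : ℕ) : poch a (n + 1) = (a + n) * poch a n := by
  have h : a + ((n + 1 : ℕ) : ℝ) = (a + n) + 1 := by push_cast; ring
  rw [poch, poch, h, Real.Gamma_add_one (by positivity)]
  ring

theorem poch_pos {a : ℝ} (ha : 0 < a) (n : ℕ) : 0 < poch a n := by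
  unfold poch
  positivity

theorem summable_hyp1F1 {a b z : ℝ} (ha : 0 < a) (hb : 0 < b) (hz : 0 < z) :
    Summable fun n : ℕ => poch a n * z ^ n / (poch b n * (n.factorial : ℝ)) := by
  have hpos : ∀ n : ℕ, 0 < poch a n * z ^ n / (poch b n * (n.factorial : ℝ)) := fun n => by
    have := poch_pos ha n
    have := poch_pos hb n
    positivity
  refine summable_of_ratio_test_tendsto_lt_one (l := 0) one_pos
    (.of_forall fun n => (hpos n).ne') ?_
  have hratio : ∀ n : ℕ, ‖poch a (n + 1) * z ^ (n + 1) /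
      (poch b (n + 1) * ((n + 1).factorial : ℝ))‖ /
      ‖poch a n * z ^ n / (poch b n * (n.factorial : ℝ))‖ =
      (1 + (a - b) * (1 / (b + n))) * (z * (1 / ((n : ℝ) + 1))) := fun n => by
    rw [Real.norm_of_nonneg (hpos _).le, Real.norm_of_nonneg (hpos _).le, poch_succ ha,
      poch_succ hb, Nat.factorial_succ]
    have := poch_pos ha n
    have := poch_pos hb n
    push_cast
    field_simp
    ring
  simp only [hratio]
  have h1 : Filter.Tendsto (fun n : ℕ => 1 / (b + (n : ℝ))) Filter.atTop (nhds 0) := by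
    simp only [one_div]
    exact tendsto_inv_atTop_zero.comp
      (Filter.tendsto_atTop_add_const_left _ b tendsto_natCast_atTop_atTop)
  have h2 := tendsto_one_div_add_atTop_nhds_zero_nat (𝕜 := ℝ)
  simpa using ((h1.const_mul (a - b)).const_add 1).mul (h2.const_mul z)

/-- Eq. (9): PDF of the single shadowed κ-μ Type III model with
inverse Nakagami-m multiplicative shadowing. -/
theorem single_shadowed_typeIII_inverse_nakagami_pdf
    (κ μ mt rhat r : ℝ)
    (hκ : 0 < κ) (hμ : 0 < μ) (hrhat : 0 < rhat) (hmt : 1 < mt) (hr : 0 < r) :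
    (∫ x in Ioi (0 : ℝ),
      (2 * μ * (1 + κ) ^ ((μ + 1) / 2) * r ^ μ *
          Real.exp (-μ * (1 + κ) * r ^ 2 / (x ^ 2 * rhat ^ 2)) /
          (κ ^ ((μ - 1) / 2) * Real.exp (κ * μ) * (x ^ 2 * rhat ^ 2) ^ ((μ + 1) / 2))) *
        besselI (μ - 1) (2 * μ * Real.sqrt (κ * (1 + κ)) * r / (x * rhat)) *
        (2 * (mt - 1) ^ mt * x ^ (-2 * mt - 1) *
          Real.exp (-(mt - 1) / x ^ 2) / Real.Gamma mt)) =
    (2 * (1 + κ) ^ μ * μ ^ μ * Real.exp (-(κ * μ)) * ((mt - 1) * rhat ^ 2) ^ mt *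
        r ^ (2 * μ - 1) /
        (betaFn mt μ * (rhat ^ 2 * (mt - 1) + r ^ 2 * (1 + κ) * μ) ^ (mt + μ))) *
      hyp1F1 (mt + μ) μ
        (μ ^ 2 * κ * (1 + κ) * r ^ 2 / (rhat ^ 2 * (mt - 1) + r ^ 2 * (1 + κ) * μ)) := by
  obtain ⟨m, rfl⟩ : ∃ m, mt = m + 1 := ⟨mt - 1, by ring⟩
  have hm : 0 < m := by linarith
  simp only [add_sub_cancel_right]
  set D := rhat ^ 2 * m + r ^ 2 * (1 + κ) * μ with hD
  have hD0 : 0 < D := by positivity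
  set A := D / rhat ^ 2 with hA
  have hA0 : 0 < A := by positivity
  set c : ℕ → ℝ := fun k => 4 * μ ^ (μ + 2 * k) * (1 + κ) ^ (μ + k) * κ ^ (k : ℝ) *
    r ^ (2 * μ - 1 + 2 * k) * rhat ^ (-2 * μ - 2 * k) * Real.exp (-(κ * μ)) * m ^ (m + 1) /
    (Real.Gamma (m + 1) * k.factorial * Real.Gamma (μ + k)) with hc
  have hc0 : ∀ k, 0 < c k := fun k => by simp only [hc]; positivity
  set f : ℕ → ℝ → ℝ := fun k x =>
    c k * (x ^ (-2 * (μ + k + (m + 1)) - 1) * Real.exp (-A / x ^ 2)) with hf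
  have hint : ∀ k, IntegrableOn (f k) (Ioi 0) := fun k =>
    (integrableOn_rpow_mul_exp_neg_div_sq (by positivity) hA0).const_mul _
  have hval : ∀ k, ∫ x in Ioi (0 : ℝ), f k x =
      c k * (Real.Gamma (μ + k + (m + 1)) * A ^ (-(μ + k + (m + 1))) / 2) := fun k => by
    rw [integral_const_mul, integral_rpow_mul_exp_neg_div_sq (by positivity) hA0]
  have hterm : ∀ k : ℕ, c k * (Real.Gamma (μ + k + (m + 1)) * A ^ (-(μ + k + (m + 1))) / 2) =
      (2 * (1 + κ) ^ μ * μ ^ μ * Real.exp (-(κ * μ)) * (m * rhat ^ 2) ^ (m + 1) *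
        r ^ (2 * μ - 1) / (betaFn (m + 1) μ * D ^ (m + 1 + μ))) *
      (poch (m + 1 + μ) k * (μ ^ 2 * κ * (1 + κ) * r ^ 2 / D) ^ k /
        (poch μ k * (k.factorial : ℝ))) := fun k => by
    simp only [hc, hA, betaFn, poch]
    rw [show μ + (k : ℝ) + (m + 1) = m + 1 + μ + k by ring]
    refine Real.log_injOn_pos (mem_Ioi.2 (by positivity)) (mem_Ioi.2 (by positivity)) ?_
    rw [show (4 : ℝ) = 2 ^ 2 by norm_num]
    simp (disch := positivity) only [Real.log_mul, Real.log_div, Real.log_rpow, Real.log_pow,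
      Real.log_exp]
    push_cast
    ring
  have hfx : ∀ x ∈ Ioi (0 : ℝ), (2 * μ * (1 + κ) ^ ((μ + 1) / 2) * r ^ μ *
          Real.exp (-μ * (1 + κ) * r ^ 2 / (x ^ 2 * rhat ^ 2)) /
          (κ ^ ((μ - 1) / 2) * Real.exp (κ * μ) * (x ^ 2 * rhat ^ 2) ^ ((μ + 1) / 2))) *
        besselI (μ - 1) (2 * μ * Real.sqrt (κ * (1 + κ)) * r / (x * rhat)) *
        (2 * m ^ (m + 1) * x ^ (-2 * (m + 1) - 1) *
          Real.exp (-m / x ^ 2) / Real.Gamma (m + 1)) = ∑' k, f k x := fun x hx => by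
    have hx : 0 < x := hx
    rw [besselI, ← tsum_mul_left, ← tsum_mul_right]
    refine tsum_congr fun k => ?_
    simp only [hf, hc]
    rw [show μ - 1 + (k : ℝ) + 1 = μ + k by ring]
    refine Real.log_injOn_pos (mem_Ioi.2 (by positivity)) (mem_Ioi.2 (by positivity)) ?_
    rw [show (4 : ℝ) = 2 ^ 2 by norm_num]
    simp (disch := positivity) only [Real.log_mul, Real.log_div, Real.log_rpow, Real.log_pow,
      Real.log_exp, Real.log_sqrt]
    have hexp : -A / x ^ 2 = -m / x ^ 2 + -μ * (1 + κ) * r ^ 2 / (x ^ 2 * rhat ^ 2) := by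
      rw [hA, hD]
      field_simp
      ring
    rw [hexp]
    push_cast
    ring
  rw [setIntegral_congr_fun measurableSet_Ioi hfx]
  have hz : 0 < μ ^ 2 * κ * (1 + κ) * r ^ 2 / D := by positivity
  have hsum : Summable fun k => ∫ x in Ioi (0 : ℝ), ‖f k x‖ := by
    have hnorm : ∀ k, ∫ x in Ioi (0 : ℝ), ‖f k x‖ = ∫ x in Ioi (0 : ℝ), f k x := fun k =>
      setIntegral_congr_fun measurableSet_Ioi fun x hx => by
        have hx : 0 < x := hx
        have := hc0 k
        exact Real.norm_of_nonneg (by simp only [hf]; positivity)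
    simp only [hnorm, hval, hterm]
    exact (summable_hyp1F1 (by positivity) hμ hz).mul_left _
  rw [← (hasSum_integral_of_summable_integral_norm hint hsum).tsum_eq, hyp1F1, ← tsum_mul_left]
  exact tsum_congr fun k => (hval k).trans (hterm k)
end

section
/- Let κ, μ, m_t, r̂ > 0, m_d > 1 and r > 0. Set K = μ(1+κ) and let t(·) be the single shadowed κ-μ Type I (inverse Nakagami-m) PDF, t(y) = ∑_{i=0}^∞ (4[(m_d−1)κ]^{(m_d+i)/2} y^{2i+2μ−1} μ^{(3i+m_d)/2+μ} (1+κ)^{i+μ} / (r̂^{2i+2μ} i! Γ(m_d) Γ(i+μ))) e^{−y²(1+κ)μ/r̂²} K_{m_d−i}(2√((m_d−1)μκ)). Then ∫₀^∞ (1/a) t(r/a) · (2 m_t^{m_t} a^{2m_t−1} e^{−m_t a²}/Γ(m_t)) da = (8 (m_t K)^{(μ+m_t)/2} r^{μ+m_t−1} (κμ(m_d−1))^{m_d/2} / (Γ(m_d) Γ(m_t) r̂^{μ+m_t})) · ∑_{i=0}^∞ (1/(i! Γ(i+μ))) (r μ √(κ(m_d−1)m_t(1+κ))/r̂)^i ·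 K_{m_d−i}(2√((m_d−1)μκ)) · K_{m_t−μ−i}(2r√(K m_t)/r̂). -/
open MeasureTheory Set

/-- Termwise integration of a pointwise summable series of nonnegative integrable functions. When
the series of integrals diverges, both sides are the junk value `0`. -/
theorem integral_tsum_of_ae_nonneg_of_ae_summable {α : Type*} [MeasurableSpace α] {ν : Measure α}
    {f : ℕ → α → ℝ} (hf : ∀ i, Integrable (f i) ν) (h0 : ∀ᵐ a ∂ν, ∀ i, 0 ≤ f i a)
    (hs : ∀ᵐ a ∂ν, Summable fun i => f i a) :
    ∫ a, ∑' i, f i a ∂ν = ∑' i, ∫ a, f i a ∂ν := by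
  have hm : AEStronglyMeasurable (fun a => ∑' i, f i a) ν := by
    have hpartial : ∀ n, AEMeasurable (fun a => ∑ i ∈ Finset.range n, f i a) ν := fun n =>
      Finset.aemeasurable_fun_sum _ fun i _ => (hf i).aemeasurable
    refine (aemeasurable_of_tendsto_metrizable_ae Filter.atTop hpartial ?_).aestronglyMeasurable
    filter_upwards [hs] with a ha using ha.hasSum.tendsto_sum_nat
  rw [integral_eq_lintegral_of_nonneg_ae
    (by filter_upwards [h0] with a ha using tsum_nonneg ha) hm]
  have hofReal : ∫⁻ a, ENNReal.ofReal (∑' i, f i a) ∂ν = ∫⁻ a, ∑' i, ENNReal.ofReal (f i a) ∂ν := by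
    refine lintegral_congr_ae ?_
    filter_upwards [h0, hs] with a ha hsa using ENNReal.ofReal_tsum_of_nonneg ha hsa
  rw [hofReal, lintegral_tsum fun i => (hf i).aemeasurable.ennreal_ofReal,
    ENNReal.tsum_toReal_eq fun i => (hf i).lintegral_lt_top.ne]
  refine tsum_congr fun i => ?_
  rw [integral_eq_lintegral_of_nonneg_ae _ (hf i).aestronglyMeasurable]
  filter_upwards [h0] with a ha using ha i

theorem integrableOn_Ioi_iff_integrable_exp_mul_comp_exp (f : ℝ → ℝ) :
    IntegrableOn f (Ioi 0) ↔ Integrable fun s => Real.exp s * f (Real.exp s) := by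
  have h := integrableOn_image_iff_integrableOn_abs_deriv_smul MeasurableSet.univ
    (fun x _ => (Real.hasDerivAt_exp x).hasDerivWithinAt) Real.exp_injective.injOn f
  simpa [Real.range_exp] using h

theorem integral_Ioi_eq_integral_exp_mul_comp_exp (f : ℝ → ℝ) :
    ∫ a in Ioi 0, f a = ∫ s, Real.exp s * f (Real.exp s) := by
  have h := integral_image_eq_integral_abs_deriv_smul MeasurableSet.univ
    (fun x _ => (Real.hasDerivAt_exp x).hasDerivWithinAt) Real.exp_injective.injOn f
  simpa [Real.range_exp] using h

theorem integral_exp_mul_exp_neg_exp {a x : ℝ} (ha : 0 < a) (hx : 0 < x) :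
    ∫ s, Real.exp (a * s) * Real.exp (-(x * Real.exp s)) = (1 / x) ^ a * Real.Gamma a := by
  rw [← Real.integral_rpow_mul_exp_neg_mul_Ioi ha hx, integral_Ioi_eq_integral_exp_mul_comp_exp]
  congr 1 with s
  simp only [← Real.exp_mul, ← Real.exp_add]
  congr 1
  ring

theorem integrable_exp_mul_exp_neg_exp {a x : ℝ} (ha : 0 < a) (hx : 0 < x) :
    Integrable fun s => Real.exp (a * s) * Real.exp (-(x * Real.exp s)) := by
  refine Integrable.of_integral_ne_zero ?_
  rw [integral_exp_mul_exp_neg_exp ha hx]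
  have := Real.Gamma_pos_of_pos ha
  positivity

theorem exp_mul_exp_neg_cosh_le {ν a x s : ℝ} (hx : 0 ≤ x) (hν : ν * s ≤ a * s) :
    Real.exp (ν * s) * Real.exp (-x * Real.cosh s) ≤
      Real.exp (a * s) * Real.exp (-(x / 2 * Real.exp s)) := by
  have hcosh : Real.exp s / 2 ≤ Real.cosh s := by
    rw [Real.cosh_eq]
    linarith [Real.exp_pos (-s)]
  gcongr
  nlinarith

theorem integrable_exp_mul_exp_neg_cosh (ν : ℝ) {x : ℝ} (hx : 0 < x) :
    Integrable fun s => Real.exp (ν * s) * Real.exp (-x * Real.cosh s) := by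
  have hg := integrable_exp_mul_exp_neg_exp (a := |ν| + 1) (by positivity) (half_pos hx)
  refine (hg.add hg.comp_neg).mono' (by fun_prop) (.of_forall fun s => ?_)
  rw [Real.norm_of_nonneg (by positivity), Pi.add_apply]
  rcases le_total 0 s with hs | hs
  · refine (exp_mul_exp_neg_cosh_le (a := |ν| + 1) hx.le ?_).trans
      (le_add_of_nonneg_right (by positivity))
    nlinarith [le_abs_self ν]
  · have h := exp_mul_exp_neg_cosh_le (ν := -ν) (a := |ν| + 1) (s := -s) hx.le
      (by nlinarith [neg_abs_le ν])
    rw [Real.cosh_neg, neg_mul_neg] at h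
    exact h.trans (le_add_of_nonneg_left (by positivity))

theorem integral_exp_mul_exp_neg_cosh (ν : ℝ) {x : ℝ} (hx : 0 < x) :
    ∫ s, Real.exp (ν * s) * Real.exp (-x * Real.cosh s) = 2 * besselK ν x := by
  have hi := integrable_exp_mul_exp_neg_cosh ν hx
  have heven : ∫ s, Real.exp (-x * Real.cosh |s|) * Real.cosh (ν * |s|) = 2 * besselK ν x :=
    integral_comp_abs (f := fun s => Real.exp (-x * Real.cosh s) * Real.cosh (ν * s))
  have hsum := integral_add hi hi.comp_neg
  rw [integral_neg_eq_self (fun s => Real.exp (ν * s) * Real.exp (-x * Real.cosh s))] at hsum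
  have hpoint : ∀ s, Real.exp (ν * s) * Real.exp (-x * Real.cosh s) +
      Real.exp (ν * -s) * Real.exp (-x * Real.cosh (-s)) =
      2 * (Real.exp (-x * Real.cosh |s|) * Real.cosh (ν * |s|)) := fun s => by
    have habs : Real.cosh (ν * |s|) = Real.cosh (ν * s) := by
      rcases abs_choice s with h | h <;> simp [h]
    rw [habs, Real.cosh_abs, Real.cosh_neg, Real.cosh_eq (ν * s), mul_neg]
    ring
  simp_rw [hpoint] at hsum
  rw [integral_const_mul, heven] at hsum
  linarith

theorem besselK_nonneg (ν x : ℝ) : 0 ≤ besselK ν x :=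
  integral_nonneg fun _ => mul_nonneg (Real.exp_nonneg _) (Real.cosh_pos _).le

theorem besselK_le_rpow_mul_Gamma {ν a x : ℝ} (ha : 0 < a) (hν : |ν| ≤ a) (hx : 0 < x) :
    besselK ν x ≤ (2 / x) ^ a * Real.Gamma a := by
  have hg := integrable_exp_mul_exp_neg_exp ha (half_pos hx)
  rw [← one_div_div, ← integral_exp_mul_exp_neg_exp ha (half_pos hx)]
  refine le_trans ?_ (setIntegral_le_integral (s := Ioi 0) hg (.of_forall fun s => by positivity))
  refine integral_mono_of_nonneg (.of_forall fun s => by positivity) hg.integrableOn ?_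
  refine (ae_restrict_iff' measurableSet_Ioi).2 (.of_forall fun s hs => ?_)
  have hs : 0 < s := hs
  refine le_trans ?_ (exp_mul_exp_neg_cosh_le (ν := a) hx.le le_rfl)
  rw [mul_comm (Real.exp (a * s))]
  refine mul_le_mul_of_nonneg_left ?_ (Real.exp_nonneg _)
  have h1 : Real.exp (ν * s) ≤ Real.exp (a * s) := by
    gcongr
    exact (le_abs_self ν).trans hν
  have h2 : Real.exp (-(ν * s)) ≤ Real.exp (a * s) := by
    rw [← neg_mul]
    gcongr
    exact (neg_le_abs ν).trans hν
  rw [Real.cosh_eq]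
  linarith

/-- The substitution `a = √(P / Q) * exp (s / 2)` in the integral over `Ioi 0`. -/
theorem exp_mul_rpow_mul_exp_comp_exp (ν : ℝ) {P Q : ℝ} (hP : 0 < P) (hQ : 0 < Q) (s : ℝ) :
    Real.exp s * (Real.exp s ^ (2 * ν - 1) *
        Real.exp (-(Q ^ 2 * Real.exp s ^ 2) - P ^ 2 / Real.exp s ^ 2)) =
      (P / Q) ^ ν * (Real.exp (ν * (2 * s - Real.log (P / Q))) *
        Real.exp (-(2 * P * Q) * Real.cosh (2 * s - Real.log (P / Q)))) := by
  have hPQ : 0 < P / Q := by positivity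
  have hcosh : -(2 * P * Q) * Real.cosh (2 * s - Real.log (P / Q)) =
      -(Q ^ 2 * Real.exp s ^ 2) - P ^ 2 / Real.exp s ^ 2 := by
    rw [Real.cosh_eq, neg_sub, Real.exp_sub, Real.exp_sub, Real.exp_log hPQ, two_mul s,
      Real.exp_add]
    field_simp
    ring
  rw [hcosh, Real.rpow_def_of_pos hPQ, ← Real.exp_mul]
  simp only [← Real.exp_add]
  congr 1
  ring

theorem integrableOn_rpow_mul_exp_neg_sq_sub_inv_sq (ν : ℝ) {P Q : ℝ} (hP : 0 < P) (hQ : 0 < Q) :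
    IntegrableOn (fun a => a ^ (2 * ν - 1) * Real.exp (-(Q ^ 2 * a ^ 2) - P ^ 2 / a ^ 2))
      (Ioi 0) := by
  rw [integrableOn_Ioi_iff_integrable_exp_mul_comp_exp]
  simp_rw [exp_mul_rpow_mul_exp_comp_exp ν hP hQ]
  exact (((integrable_exp_mul_exp_neg_cosh ν (x := 2 * P * Q) (by positivity)).comp_sub_right
    (Real.log (P / Q))).comp_mul_left' two_ne_zero).const_mul _

theorem integral_rpow_mul_exp_neg_sq_sub_inv_sq (ν : ℝ) {P Q : ℝ} (hP : 0 < P) (hQ : 0 < Q) :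
    ∫ a in Ioi 0, a ^ (2 * ν - 1) * Real.exp (-(Q ^ 2 * a ^ 2) - P ^ 2 / a ^ 2) =
      (P / Q) ^ ν * besselK ν (2 * P * Q) := by
  rw [integral_Ioi_eq_integral_exp_mul_comp_exp]
  simp_rw [exp_mul_rpow_mul_exp_comp_exp ν hP hQ]
  rw [integral_const_mul, Measure.integral_comp_mul_left (fun u =>
      Real.exp (ν * (u - Real.log (P / Q))) *
        Real.exp (-(2 * P * Q) * Real.cosh (u - Real.log (P / Q)))) 2,
    integral_sub_right_eq_self (fun u =>
      Real.exp (ν * u) * Real.exp (-(2 * P * Q) * Real.cosh u)),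
    integral_exp_mul_exp_neg_cosh ν (by positivity), abs_of_pos (by positivity), smul_eq_mul]
  ring

theorem summable_pow_mul_Gamma_div {μ m : ℝ} (hμ : 0 < μ) (hm : 0 < m) {z : ℝ} (hz : 0 < z) :
    Summable fun i : ℕ =>
      z ^ i * Real.Gamma (m + i) / ((i.factorial : ℝ) * Real.Gamma ((i : ℝ) + μ)) := by
  have hG : ∀ {c : ℝ}, 0 < c → ∀ i : ℕ, 0 < Real.Gamma (i + c) := fun hc i =>
    Real.Gamma_pos_of_pos (by positivity)
  simp_rw [add_comm m]
  have hpos : ∀ i : ℕ, 0 <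
      z ^ i * Real.Gamma (i + m) / ((i.factorial : ℝ) * Real.Gamma ((i : ℝ) + μ)) := fun i => by
    have := hG hm i
    have := hG hμ i
    positivity
  refine summable_of_ratio_test_tendsto_lt_one zero_lt_one
    (.of_forall fun i => (hpos i).ne') ?_
  have hratio : ∀ i : ℕ,
      ‖z ^ (i + 1) * Real.Gamma ((i + 1 : ℕ) + m) /
          (((i + 1).factorial : ℝ) * Real.Gamma (((i + 1 : ℕ) : ℝ) + μ))‖ /
        ‖z ^ i * Real.Gamma (i + m) / ((i.factorial : ℝ) * Real.Gamma ((i : ℝ) + μ))‖ =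
      z * (1 / ((i : ℝ) + 1)) * ((m + 1 * i) / (μ + 1 * i)) := fun i => by
    rw [Real.norm_of_nonneg (hpos _).le, Real.norm_of_nonneg (hpos _).le, Nat.factorial_succ]
    push_cast
    rw [add_right_comm, add_right_comm (i : ℝ) 1 μ, Real.Gamma_add_one (by positivity),
      Real.Gamma_add_one (by positivity)]
    have := (hG hm i).ne'
    have := (hG hμ i).ne'
    have := Nat.factorial_ne_zero i
    field_simp
    ring
  simp_rw [hratio]
  have hlim := (tendsto_one_div_add_atTop_nhds_zero_nat (𝕜 := ℝ)).const_mul z |>.mul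
    (tendsto_add_mul_div_add_mul_atTop_nhds m μ 1 one_ne_zero)
  simpa using hlim

/-- The power-function factors of the `i`-th term of the inverse Nakagami-`m` shadowed density are
geometric in `i`. -/
theorem shadowed_coeff_eq_mul_pow {κ μ md rhat y : ℝ} (hκ : 0 < κ) (hμ : 0 < μ) (hrhat : 0 < rhat)
    (hmd : 1 < md) (hy : 0 < y) (i : ℕ) :
    ((md - 1) * κ) ^ ((md + (i : ℝ)) / 2) * y ^ (2 * (i : ℝ) + 2 * μ - 1) *
        μ ^ ((3 * (i : ℝ) + md) / 2 + μ) * (1 + κ) ^ ((i : ℝ) + μ) /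
        rhat ^ (2 * (i : ℝ) + 2 * μ) =
      (((md - 1) * κ) ^ (md / 2) * y ^ (2 * μ - 1) * μ ^ (md / 2 + μ) * (1 + κ) ^ μ /
          rhat ^ (2 * μ)) *
        (((md - 1) * κ) ^ (1 / 2 : ℝ) * y ^ (2 : ℝ) * μ ^ (3 / 2 : ℝ) * (1 + κ) /
          rhat ^ (2 : ℝ)) ^ i := by
  have hα : 0 < md - 1 := sub_pos.2 hmd
  have hA : 0 < (md - 1) * κ := by positivity
  rw [← Real.rpow_natCast]
  generalize (md - 1) * κ = A at hA ⊢
  refine Real.log_injOn_pos (mem_Ioi.2 (by positivity)) (mem_Ioi.2 (by positivity)) ?_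
  simp (disch := positivity) only [Real.log_mul, Real.log_div, Real.log_rpow]
  ring

theorem summable_shadowed_density {κ μ md rhat y : ℝ} (hκ : 0 < κ) (hμ : 0 < μ) (hrhat : 0 < rhat)
    (hmd : 1 < md) (hy : 0 < y) :
    Summable fun i : ℕ =>
      (4 * ((md - 1) * κ) ^ ((md + (i : ℝ)) / 2) * y ^ (2 * (i : ℝ) + 2 * μ - 1) *
          μ ^ ((3 * (i : ℝ) + md) / 2 + μ) * (1 + κ) ^ ((i : ℝ) + μ) /
          (rhat ^ (2 * (i : ℝ) + 2 * μ) * (i.factorial : ℝ) * Real.Gamma md *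
            Real.Gamma ((i : ℝ) + μ))) *
        Real.exp (-(y ^ 2) * (1 + κ) * μ / rhat ^ 2) *
        besselK (md - (i : ℝ)) (2 * Real.sqrt ((md - 1) * μ * κ)) := by
  have hα : 0 < md - 1 := sub_pos.2 hmd
  have hmd0 : 0 < md := by linarith
  have hG := Real.Gamma_pos_of_pos hmd0
  obtain ⟨x, hx⟩ : ∃ x, x = 2 * Real.sqrt ((md - 1) * μ * κ) := ⟨_, rfl⟩
  have hx0 : 0 < x := hx ▸ by positivity
  rw [← hx]
  obtain ⟨D, hD⟩ : ∃ D, D = ((md - 1) * κ) ^ (md / 2) * y ^ (2 * μ - 1) * μ ^ (md / 2 + μ) *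
    (1 + κ) ^ μ / rhat ^ (2 * μ) := ⟨_, rfl⟩
  obtain ⟨z, hz⟩ : ∃ z, z = ((md - 1) * κ) ^ (1 / 2 : ℝ) * y ^ (2 : ℝ) * μ ^ (3 / 2 : ℝ) *
    (1 + κ) / rhat ^ (2 : ℝ) := ⟨_, rfl⟩
  have hD0 : 0 < D := hD ▸ by positivity
  have hz0 : 0 < z := hz ▸ by positivity
  have hs := (summable_pow_mul_Gamma_div hμ hmd0 (z := z * (2 / x)) (by positivity)).mul_left
    (4 * D * Real.exp (-(y ^ 2) * (1 + κ) * μ / rhat ^ 2) * (2 / x) ^ md / Real.Gamma md)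
  have hGi : ∀ i : ℕ, 0 < Real.Gamma (i + μ) := fun i => Real.Gamma_pos_of_pos (by positivity)
  refine hs.of_nonneg_of_le (fun i => ?_) fun i => ?_
  · have := hGi i
    have := besselK_nonneg (md - i) x
    positivity
  · have hK := besselK_le_rpow_mul_Gamma (ν := md - i) (a := md + i) (by positivity)
      (abs_le.2 ⟨by linarith, by linarith [(Nat.cast_nonneg i : (0 : ℝ) ≤ i)]⟩) hx0
    have := hGi i
    have hc := shadowed_coeff_eq_mul_pow hκ hμ hrhat hmd hy i
    rw [← hD, ← hz] at hc
    refine (mul_le_mul_of_nonneg_left hK (by positivity)).trans_eq ?_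
    rw [Real.rpow_add (x := 2 / x) (by positivity), Real.rpow_natCast, mul_pow]
    calc _ = (((md - 1) * κ) ^ ((md + (i : ℝ)) / 2) * y ^ (2 * (i : ℝ) + 2 * μ - 1) *
          μ ^ ((3 * (i : ℝ) + md) / 2 + μ) * (1 + κ) ^ ((i : ℝ) + μ) /
          rhat ^ (2 * (i : ℝ) + 2 * μ)) * (4 * Real.exp (-(y ^ 2) * (1 + κ) * μ / rhat ^ 2) *
          ((2 / x) ^ md * (2 / x) ^ i * Real.Gamma (md + i)) /
          ((i.factorial : ℝ) * Real.Gamma md * Real.Gamma ((i : ℝ) + μ))) := by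
          field_simp
      _ = _ := by
          rw [hc]
          field_simp

/-- The `i`-th term of the product-density integrand, as a multiple of the kernel in
`integral_rpow_mul_exp_neg_sq_sub_inv_sq`. -/
theorem shadowed_term_mul_nakagami {κ μ mt md rhat r a : ℝ} (hκ : 0 < κ) (hμ : 0 < μ)
    (hmt : 0 < mt) (hr : 0 < r) (ha : 0 < a) (i : ℕ) (B : ℝ) :
    (1 / a) *
        ((4 * ((md - 1) * κ) ^ ((md + (i : ℝ)) / 2) * (r / a) ^ (2 * (i : ℝ) + 2 * μ - 1) *
            μ ^ ((3 * (i : ℝ) + md) / 2 + μ) * (1 + κ) ^ ((i : ℝ) + μ) /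
            (rhat ^ (2 * (i : ℝ) + 2 * μ) * (i.factorial : ℝ) * Real.Gamma md *
              Real.Gamma ((i : ℝ) + μ))) *
          Real.exp (-((r / a) ^ 2) * (1 + κ) * μ / rhat ^ 2) * B) *
        (2 * mt ^ mt * a ^ (2 * mt - 1) * Real.exp (-mt * a ^ 2) / Real.Gamma mt) =
      (4 * ((md - 1) * κ) ^ ((md + (i : ℝ)) / 2) * r ^ (2 * (i : ℝ) + 2 * μ - 1) *
            μ ^ ((3 * (i : ℝ) + md) / 2 + μ) * (1 + κ) ^ ((i : ℝ) + μ) /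
            (rhat ^ (2 * (i : ℝ) + 2 * μ) * (i.factorial : ℝ) * Real.Gamma md *
              Real.Gamma ((i : ℝ) + μ)) * B * (2 * mt ^ mt / Real.Gamma mt)) *
        (a ^ (2 * (mt - μ - i) - 1) *
          Real.exp (-(Real.sqrt mt ^ 2 * a ^ 2) -
            (r * Real.sqrt (μ * (1 + κ)) / rhat) ^ 2 / a ^ 2)) := by
  have hpow : a ^ (2 * (mt - μ - i) - 1) =
      a⁻¹ * (a ^ (2 * (i : ℝ) + 2 * μ - 1))⁻¹ * a ^ (2 * mt - 1) := by
    rw [← Real.rpow_neg_one, ← Real.rpow_neg ha.le, ← Real.rpow_add ha, ← Real.rpow_add ha]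
    ring_nf
  have hexp : Real.exp (-(Real.sqrt mt ^ 2 * a ^ 2) -
        (r * Real.sqrt (μ * (1 + κ)) / rhat) ^ 2 / a ^ 2) =
      Real.exp (-((r / a) ^ 2) * (1 + κ) * μ / rhat ^ 2) * Real.exp (-mt * a ^ 2) := by
    rw [← Real.exp_add, Real.sq_sqrt hmt.le, div_pow, mul_pow, Real.sq_sqrt (by positivity)]
    ring_nf
  rw [hpow, hexp, Real.div_rpow hr.le ha.le]
  ring

theorem shadowed_coeff_mul_rpow {κ μ mt md rhat r : ℝ} (hκ : 0 < κ) (hμ : 0 < μ) (hmt : 0 < mt)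
    (hrhat : 0 < rhat) (hmd : 1 < md) (hr : 0 < r) (i : ℕ) :
    ((md - 1) * κ) ^ ((md + (i : ℝ)) / 2) * r ^ (2 * (i : ℝ) + 2 * μ - 1) *
        μ ^ ((3 * (i : ℝ) + md) / 2 + μ) * (1 + κ) ^ ((i : ℝ) + μ) /
        rhat ^ (2 * (i : ℝ) + 2 * μ) * mt ^ mt *
        (r * Real.sqrt (μ * (1 + κ)) / rhat / Real.sqrt mt) ^ (mt - μ - i) =
      (mt * (μ * (1 + κ))) ^ ((μ + mt) / 2) * r ^ (μ + mt - 1) *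
          (κ * μ * (md - 1)) ^ (md / 2) / rhat ^ (μ + mt) *
        (r * μ * Real.sqrt (κ * (md - 1) * mt * (1 + κ)) / rhat) ^ i := by
  have hα : 0 < md - 1 := sub_pos.2 hmd
  have hκ1 : 0 < 1 + κ := by positivity
  rw [← Real.rpow_natCast]
  generalize md - 1 = α at hα ⊢
  generalize 1 + κ = B at hκ1 ⊢
  refine Real.log_injOn_pos (mem_Ioi.2 (by positivity)) (mem_Ioi.2 (by positivity)) ?_
  simp (disch := positivity) only [Real.log_mul, Real.log_div, Real.log_rpow, Real.log_sqrt]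
  ring

/-- Theorem 6: PDF of the double shadowed κ-μ Type I model, example 2,
obtained as the product of a Nakagami-m RV and a single shadowed κ-μ Type I
(inverse Nakagami-m) RV. -/
theorem double_shadowed_typeI_example2_pdf
    (κ μ mt md rhat r K : ℝ) (t : ℝ → ℝ)
    (hκ : 0 < κ) (hμ : 0 < μ) (hmt : 0 < mt) (hrhat : 0 < rhat) (hmd : 1 < md)
    (hr : 0 < r) (hK : K = μ * (1 + κ))
    (ht : ∀ y : ℝ, t y =
      ∑' i : ℕ,
        (4 * ((md - 1) * κ) ^ ((md + (i : ℝ)) / 2) * y ^ (2 * (i : ℝ) + 2 * μ - 1) *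
            μ ^ ((3 * (i : ℝ) + md) / 2 + μ) * (1 + κ) ^ ((i : ℝ) + μ) /
            (rhat ^ (2 * (i : ℝ) + 2 * μ) * (i.factorial : ℝ) * Real.Gamma md *
              Real.Gamma ((i : ℝ) + μ))) *
          Real.exp (-(y ^ 2) * (1 + κ) * μ / rhat ^ 2) *
          besselK (md - (i : ℝ)) (2 * Real.sqrt ((md - 1) * μ * κ))) :
    (∫ a in Ioi (0 : ℝ),
      (1 / a) * t (r / a) *
        (2 * mt ^ mt * a ^ (2 * mt - 1) * Real.exp (-mt * a ^ 2) / Real.Gamma mt)) =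
    (8 * (mt * K) ^ ((μ + mt) / 2) * r ^ (μ + mt - 1) *
        (κ * μ * (md - 1)) ^ (md / 2) /
        (Real.Gamma md * Real.Gamma mt * rhat ^ (μ + mt))) *
      ∑' i : ℕ,
        (1 / ((i.factorial : ℝ) * Real.Gamma ((i : ℝ) + μ))) *
          (r * μ * Real.sqrt (κ * (md - 1) * mt * (1 + κ)) / rhat) ^ (i : ℕ) *
          besselK (md - (i : ℝ)) (2 * Real.sqrt ((md - 1) * μ * κ)) *
          besselK (mt - μ - (i : ℝ)) (2 * r * Real.sqrt (K * mt) / rhat) := by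
  subst hK
  have hα : 0 < md - 1 := sub_pos.2 hmd
  have hP : 0 < r * Real.sqrt (μ * (1 + κ)) / rhat := by positivity
  have hQ : 0 < Real.sqrt mt := by positivity
  have hGmd := Real.Gamma_pos_of_pos (zero_lt_one.trans hmd)
  have hGmt := Real.Gamma_pos_of_pos hmt
  simp_rw [ht, ← tsum_mul_left, ← tsum_mul_right]
  rw [integral_tsum_of_ae_nonneg_of_ae_summable]
  · refine tsum_congr fun i => ?_
    have hGi : 0 < Real.Gamma (i + μ) := Real.Gamma_pos_of_pos (by positivity)
    rw [setIntegral_congr_fun measurableSet_Ioi fun a ha =>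
        shadowed_term_mul_nakagami hκ hμ hmt hr ha i _,
      integral_const_mul, integral_rpow_mul_exp_neg_sq_sub_inv_sq _ hP hQ]
    have harg : 2 * (r * Real.sqrt (μ * (1 + κ)) / rhat) * Real.sqrt mt =
        2 * r * Real.sqrt (μ * (1 + κ) * mt) / rhat := by
      rw [Real.sqrt_mul (x := μ * (1 + κ)) (by positivity)]
      ring
    rw [harg]
    have hc := shadowed_coeff_mul_rpow hκ hμ hmt hrhat hmd hr i
    generalize besselK (md - i) _ = B₁
    generalize besselK (mt - μ - i) _ = B₂
    calc _ = (((md - 1) * κ) ^ ((md + (i : ℝ)) / 2) * r ^ (2 * (i : ℝ) + 2 * μ - 1) *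
          μ ^ ((3 * (i : ℝ) + md) / 2 + μ) * (1 + κ) ^ ((i : ℝ) + μ) /
          rhat ^ (2 * (i : ℝ) + 2 * μ) * mt ^ mt *
          (r * Real.sqrt (μ * (1 + κ)) / rhat / Real.sqrt mt) ^ (mt - μ - i)) *
          (8 * B₁ * B₂ / ((i.factorial : ℝ) * Real.Gamma md * Real.Gamma ((i : ℝ) + μ) *
            Real.Gamma mt)) := by
          ring
      _ = _ := by
          rw [hc]
          ring
  · intro i
    refine IntegrableOn.congr_fun ?_ (fun a ha =>
      (shadowed_term_mul_nakagami hκ hμ hmt hr ha i _).symm) measurableSet_Ioi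
    exact (integrableOn_rpow_mul_exp_neg_sq_sub_inv_sq _ hP hQ).const_mul _
  · refine (ae_restrict_iff' measurableSet_Ioi).2 (.of_forall fun a ha i => ?_)
    have ha : 0 < a := ha
    have := besselK_nonneg (md - i) (2 * Real.sqrt ((md - 1) * μ * κ))
    have hGi : 0 < Real.Gamma (i + μ) := Real.Gamma_pos_of_pos (by positivity)
    positivity
  · refine (ae_restrict_iff' measurableSet_Ioi).2 (.of_forall fun a ha => ?_)
    exact ((summable_shadowed_density hκ hμ hrhat hmd (div_pos hr ha)).mul_left _).mul_right _
end
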